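/- The symmetric group Equiv.Perm (Fin 6) acts transitively on Segre collections by conjugation: for any two Segre collections S and S' there exists g ∈ Equiv.Perm (Fin 6) such that {g σ g⁻¹ : σ ∈ S} = S'. -/

import Mathlib

/-- A matching of `Fin 6`: a fixed-point-free involution. -/
def IsMatching (σ : Equiv.Perm (Fin 6)) : Prop :=
  (∀ x, σ (σ x) = x) ∧ ∀ x, σ x ≠ x

/-- Two matchings are disjoint if they share no pair. -/
def DisjointMatchings (σ τ : Equiv.Perm (Fin 6)) : Prop :=
  ∀ x, σ x ≠ τ x

/-- A Segre collection: a set of five pairwise disjoint matchings of `Fin 6`. -/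
def IsSegreCollection (S : Finset (Equiv.Perm (Fin 6))) : Prop :=
  S.card = 5 ∧ (∀ σ ∈ S, IsMatching σ) ∧
    ∀ σ ∈ S, ∀ τ ∈ S, σ ≠ τ → DisjointMatchings σ τ

namespace SegreAux

instance (σ : Equiv.Perm (Fin 6)) : Decidable (IsMatching σ) := by
  unfold IsMatching; infer_instance

instance (σ τ : Equiv.Perm (Fin 6)) : Decidable (DisjointMatchings σ τ) := by
  unfold DisjointMatchings; infer_instance

/-- Explicit matching given by its table of values. -/
def mk (f : Fin 6 → Fin 6) (h : ∀ x, f (f x) = x) : Equiv.Perm (Fin 6) := ⟨f, f, h, h⟩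

def s0 : Equiv.Perm (Fin 6) := mk ![1, 0, 3, 2, 5, 4] (by decide)
def t0 : Equiv.Perm (Fin 6) := mk ![5, 2, 1, 4, 3, 0] (by decide)
def a0 : Equiv.Perm (Fin 6) := mk ![3, 4, 5, 0, 1, 2] (by decide)
def b0 : Equiv.Perm (Fin 6) := mk ![3, 5, 4, 0, 2, 1] (by decide)
def c0 : Equiv.Perm (Fin 6) := mk ![2, 4, 0, 5, 1, 3] (by decide)
def d0 : Equiv.Perm (Fin 6) := mk ![4, 3, 5, 1, 0, 2] (by decide)

/-- The vertices of the hexagon formed by two disjoint matchings. -/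
def hex (σ τ : Equiv.Perm (Fin 6)) : Fin 6 → Fin 6 :=
  ![0, σ 0, τ (σ 0), σ (τ (σ 0)), τ (σ (τ (σ 0))), σ (τ (σ (τ (σ 0))))]

theorem exists_notMem_four (a b c d : Fin 6) :
    ∃ p, p ∉ ({a, b, c, d} : Finset (Fin 6)) := by
  by_contra! h
  have h1 : (Finset.univ : Finset (Fin 6)) ⊆ {a, b, c, d} := fun p _ => h p
  have h2 := Finset.card_le_card h1
  have h3 := Finset.card_le_four (a := a) (b := b) (c := c) (d := d)
  simp only [Finset.card_univ, Fintype.card_fin] at h2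
  omega

theorem mem_of_six (l : Finset (Fin 6)) (hl : l.card = 6) (p : Fin 6) : p ∈ l := by
  have : l = Finset.univ := Finset.eq_univ_of_card l (by simpa using hl)
  rw [this]
  exact Finset.mem_univ p

theorem no_four_cycle (σ τ : Equiv.Perm (Fin 6)) (hσ : IsMatching σ) (hτ : IsMatching τ)
    (hd : DisjointMatchings σ τ) (x y z w : Fin 6) (h1 : σ x = y) (h2 : τ y = z)
    (h3 : σ z = w) : τ w ≠ x := by
  intro h4
  obtain ⟨hσ1, hσ2⟩ := hσ
  obtain ⟨hτ1, hτ2⟩ := hτ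
  obtain ⟨p, hp⟩ := exists_notMem_four x y z w
  have hc : ({x, y, z, w, p, σ p} : Finset (Fin 6)).card = 6 := by
    have := hσ1 p
    have := hσ2 p
    have := hσ1 x
    have := hσ2 x
    have := hσ1 z
    have := hσ2 z
    have := hτ1 y
    have := hτ2 y
    have := hτ1 w
    have := hτ2 w
    have := hd x
    have := hd y
    simp only [Finset.mem_insert, Finset.mem_singleton, not_or] at hp
    repeat rw [Finset.card_insert_of_notMem (by
      simp only [Finset.mem_insert, Finset.mem_singleton, not_or]; grind)]
    rw [Finset.card_singleton]
  have hm := mem_of_six _ hc (τ p)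
  have := hd p
  have := hτ1 p
  have := hτ2 p
  have := hτ1 y
  have := hτ1 w
  simp only [Finset.mem_insert, Finset.mem_singleton, not_or] at hp hm
  grind

theorem hex_spec (σ : Equiv.Perm (Fin 6)) (hσ : IsMatching σ)
    (τ : Equiv.Perm (Fin 6)) (hτ : IsMatching τ) (hd : DisjointMatchings σ τ) :
      (∀ x y, hex σ τ x = hex σ τ y → x = y) ∧
      (∀ x, σ (hex σ τ x) = hex σ τ (s0 x)) ∧ (∀ x, τ (hex σ τ x) = hex σ τ (t0 x)) := by
  have hn := no_four_cycle σ τ hσ hτ hd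
  obtain ⟨hσ1, hσ2⟩ := hσ
  obtain ⟨hτ1, hτ2⟩ := hτ
  obtain ⟨x0, e0⟩ : ∃ x, x = (0 : Fin 6) := ⟨_, rfl⟩
  obtain ⟨x1, e1⟩ : ∃ x, x = σ x0 := ⟨_, rfl⟩
  obtain ⟨x2, e2⟩ : ∃ x, x = τ x1 := ⟨_, rfl⟩
  obtain ⟨x3, e3⟩ : ∃ x, x = σ x2 := ⟨_, rfl⟩
  obtain ⟨x4, e4⟩ : ∃ x, x = τ x3 := ⟨_, rfl⟩
  obtain ⟨x5, e5⟩ : ∃ x, x = σ x4 := ⟨_, rfl⟩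
  have hx : hex σ τ = ![x0, x1, x2, x3, x4, x5] := by
    simp only [hex, e5, e4, e3, e2, e1, e0]
  have f1 : σ x1 = x0 := by rw [e1, hσ1]
  have f2 : τ x2 = x1 := by rw [e2, hτ1]
  have f3 : σ x3 = x2 := by rw [e3, hσ1]
  have f4 : τ x4 = x3 := by rw [e4, hτ1]
  have f5 : σ x5 = x4 := by rw [e5, hσ1]
  have n40 : x4 ≠ x0 := by
    rw [e4]; exact hn x0 x1 x2 x3 e1.symm e2.symm e3.symm
  clear hn e0
  have n01 : x0 ≠ x1 := by grind
  have n12 : x1 ≠ x2 := by grind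
  have n02 : x0 ≠ x2 := by have := hd x0; grind
  have n23 : x2 ≠ x3 := by grind
  have n13 : x1 ≠ x3 := by grind
  have n03 : x0 ≠ x3 := by grind
  have n34 : x3 ≠ x4 := by grind
  have n24 : x2 ≠ x4 := by have := hd x2; grind
  have n14 : x1 ≠ x4 := by grind
  have n45 : x4 ≠ x5 := by grind
  have n35 : x3 ≠ x5 := by grind
  have n25 : x2 ≠ x5 := by grind
  have n15 : x1 ≠ x5 := by grind
  have n05 : x0 ≠ x5 := by grind
  have hinj : ∀ x y, hex σ τ x = hex σ τ y → x = y := by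
    rw [hx]
    intro x y h
    fin_cases x <;> fin_cases y <;> first | rfl | (exfalso; simp at h; grind)
  have hsurj : Function.Surjective (hex σ τ) :=
    Finite.injective_iff_surjective.1 (fun x y h => hinj x y h)
  have f6 : τ x5 = x0 := by
    obtain ⟨i, hi⟩ := hsurj (τ x5)
    rw [hx] at hi
    have := hτ1 x5
    have := hτ2 x5
    fin_cases i <;> simp at hi <;> grind
  have f7 : τ x0 = x5 := by rw [← f6, hτ1]
  refine ⟨hinj, ?_, ?_⟩
  · rw [hx]
    intro x
    fin_cases x <;> simp [s0, mk, ← e1, ← e3, ← e5, f1, f3, f5]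
  · rw [hx]
    intro x
    fin_cases x <;> simp [t0, mk, ← e2, ← e4, f7, f2, f4, f6]

theorem prism (ρ : Equiv.Perm (Fin 6)) (hρ : IsMatching ρ)
    (hs : DisjointMatchings ρ s0) (ht : DisjointMatchings ρ t0) :
      ρ = a0 ∨ ρ = b0 ∨ ρ = c0 ∨ ρ = d0 := by
  obtain ⟨h1, h2⟩ := hρ
  have t0' : ρ 0 = 2 ∨ ρ 0 = 3 ∨ ρ 0 = 4 :=
    (by decide : ∀ u : Fin 6, u ≠ 0 → u ≠ 1 → u ≠ 5 → u = 2 ∨ u = 3 ∨ u = 4) _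
      (h2 0) (hs 0) (ht 0)
  have t1' : ρ 1 = 3 ∨ ρ 1 = 4 ∨ ρ 1 = 5 :=
    (by decide : ∀ u : Fin 6, u ≠ 1 → u ≠ 0 → u ≠ 2 → u = 3 ∨ u = 4 ∨ u = 5) _
      (h2 1) (hs 1) (ht 1)
  have t2' : ρ 2 = 0 ∨ ρ 2 = 4 ∨ ρ 2 = 5 :=
    (by decide : ∀ u : Fin 6, u ≠ 2 → u ≠ 3 → u ≠ 1 → u = 0 ∨ u = 4 ∨ u = 5) _
      (h2 2) (hs 2) (ht 2)
  have t3' : ρ 3 = 0 ∨ ρ 3 = 1 ∨ ρ 3 = 5 :=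
    (by decide : ∀ u : Fin 6, u ≠ 3 → u ≠ 2 → u ≠ 4 → u = 0 ∨ u = 1 ∨ u = 5) _
      (h2 3) (hs 3) (ht 3)
  have t4' : ρ 4 = 0 ∨ ρ 4 = 1 ∨ ρ 4 = 2 :=
    (by decide : ∀ u : Fin 6, u ≠ 4 → u ≠ 5 → u ≠ 3 → u = 0 ∨ u = 1 ∨ u = 2) _
      (h2 4) (hs 4) (ht 4)
  have t5' : ρ 5 = 1 ∨ ρ 5 = 2 ∨ ρ 5 = 3 :=
    (by decide : ∀ u : Fin 6, u ≠ 5 → u ≠ 4 → u ≠ 0 → u = 1 ∨ u = 2 ∨ u = 3) _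
      (h2 5) (hs 5) (ht 5)
  have ext6 : ∀ π : Equiv.Perm (Fin 6), ρ 0 = π 0 → ρ 1 = π 1 → ρ 2 = π 2 → ρ 3 = π 3 →
      ρ 4 = π 4 → ρ 5 = π 5 → ρ = π := by
    intro π g0 g1 g2 g3 g4 g5
    ext x
    fin_cases x <;> simp [*]
  have i0 := h1 0
  have i1 := h1 1
  have i2 := h1 2
  have i3 := h1 3
  have i4 := h1 4
  have i5 := h1 5
  have key : (ρ 0 = 3 ∧ ρ 1 = 4 ∧ ρ 2 = 5 ∧ ρ 3 = 0 ∧ ρ 4 = 1 ∧ ρ 5 = 2) ∨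
      (ρ 0 = 3 ∧ ρ 1 = 5 ∧ ρ 2 = 4 ∧ ρ 3 = 0 ∧ ρ 4 = 2 ∧ ρ 5 = 1) ∨
      (ρ 0 = 2 ∧ ρ 1 = 4 ∧ ρ 2 = 0 ∧ ρ 3 = 5 ∧ ρ 4 = 1 ∧ ρ 5 = 3) ∨
      (ρ 0 = 4 ∧ ρ 1 = 3 ∧ ρ 2 = 5 ∧ ρ 3 = 1 ∧ ρ 4 = 0 ∧ ρ 5 = 2) := by
    clear ext6 hs ht h1 h2
    rcases t0' with h | h | h <;> rcases t1' with h' | h' | h' <;> rw [h] at i0 <;>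
      rw [h'] at i1 <;> grind
  rcases key with ⟨g0, g1, g2, g3, g4, g5⟩ | ⟨g0, g1, g2, g3, g4, g5⟩ |
    ⟨g0, g1, g2, g3, g4, g5⟩ | ⟨g0, g1, g2, g3, g4, g5⟩
  · exact Or.inl (ext6 _ g0 g1 g2 g3 g4 g5)
  · exact Or.inr (Or.inl (ext6 _ g0 g1 g2 g3 g4 g5))
  · exact Or.inr (Or.inr (Or.inl (ext6 _ g0 g1 g2 g3 g4 g5)))
  · exact Or.inr (Or.inr (Or.inr (ext6 _ g0 g1 g2 g3 g4 g5)))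

theorem eq_of_mem (T : Finset (Equiv.Perm (Fin 6))) (hT : IsSegreCollection T)
    (hs : s0 ∈ T) (ht : t0 ∈ T) : T = {s0, t0, b0, c0, d0} := by
  obtain ⟨hc, hm, hd⟩ := hT
  have key : ∀ ρ ∈ T, ρ = s0 ∨ ρ = t0 ∨ ρ = a0 ∨ ρ = b0 ∨ ρ = c0 ∨ ρ = d0 := by
    intro ρ hρ
    by_cases h1 : ρ = s0
    · exact Or.inl h1
    by_cases h2 : ρ = t0
    · exact Or.inr (Or.inl h2)
    exact Or.inr (Or.inr (prism ρ (hm ρ hρ) (hd ρ hρ _ hs h1) (hd ρ hρ _ ht h2)))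
  have ha : a0 ∉ T := by
    intro ha
    have hb : b0 ∉ T := fun h => absurd (hd _ ha _ h (by decide)) (by decide)
    have hc' : c0 ∉ T := fun h => absurd (hd _ ha _ h (by decide)) (by decide)
    have hd' : d0 ∉ T := fun h => absurd (hd _ ha _ h (by decide)) (by decide)
    have hsub : T ⊆ {s0, t0, a0} := by
      intro ρ hρ
      rcases key ρ hρ with h | h | h | h | h | h <;> subst h <;> simp_all
    have := Finset.card_le_card hsub
    have := Finset.card_le_three (a := s0) (b := t0) (c := a0)
    omega
  apply Finset.eq_of_subset_of_card_le
  · intro ρ hρ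
    rcases key ρ hρ with h | h | h | h | h | h <;> subst h <;> simp_all
  · rw [hc]; exact Finset.card_le_five

theorem conj_segre (S : Finset (Equiv.Perm (Fin 6))) (hS : IsSegreCollection S)
    (g : Equiv.Perm (Fin 6)) : IsSegreCollection (S.image (fun σ => g * σ * g⁻¹)) := by
  obtain ⟨hc, hm, hd⟩ := hS
  refine ⟨?_, ?_, ?_⟩
  · rw [Finset.card_image_of_injective _ (fun x y h => by simpa using h), hc]
  · intro σ hσ
    obtain ⟨σ, h, rfl⟩ := Finset.mem_image.1 hσ
    refine ⟨fun x => by simp [(hm σ h).1], fun x hx => (hm σ h).2 (g⁻¹ x) ?_⟩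
    apply g.injective
    simpa using hx
  · intro σ hσ τ hτ hne
    obtain ⟨σ, h, rfl⟩ := Finset.mem_image.1 hσ
    obtain ⟨τ, h', rfl⟩ := Finset.mem_image.1 hτ
    intro x hx
    refine hd σ h τ h' (fun e => hne (by rw [e])) (g⁻¹ x) ?_
    apply g.injective
    simpa using hx

theorem to_std (S : Finset (Equiv.Perm (Fin 6))) (hS : IsSegreCollection S) :
    ∃ g : Equiv.Perm (Fin 6), S.image (fun σ => g * σ * g⁻¹) = {s0, t0, b0, c0, d0} := by
  obtain ⟨σ, hσ, τ, hτ, hne⟩ := Finset.one_lt_card.1 (by rw [hS.1]; norm_num : 1 < S.card)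
  obtain ⟨hi, h1, h2⟩ := hex_spec σ (hS.2.1 σ hσ) τ (hS.2.1 τ hτ) (hS.2.2 σ hσ τ hτ hne)
  let e : Equiv.Perm (Fin 6) :=
    Equiv.ofBijective (hex σ τ) (Finite.injective_iff_bijective.1 (fun x y h => hi x y h))
  have e1 : σ * e = e * s0 := Equiv.ext h1
  have e2 : τ * e = e * t0 := Equiv.ext h2
  refine ⟨e⁻¹, eq_of_mem _ (conj_segre S hS _) ?_ ?_⟩
  · exact Finset.mem_image.2 ⟨σ, hσ, by rw [inv_inv, mul_assoc, e1, inv_mul_cancel_left]⟩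
  · exact Finset.mem_image.2 ⟨τ, hτ, by rw [inv_inv, mul_assoc, e2, inv_mul_cancel_left]⟩

end SegreAux

/-- `S₆` acts transitively on Segre collections by conjugation. -/
theorem segre_collections_conj_transitive (S S' : Finset (Equiv.Perm (Fin 6)))
    (hS : IsSegreCollection S) (hS' : IsSegreCollection S') :
    ∃ g : Equiv.Perm (Fin 6), S.image (fun σ => g * σ * g⁻¹) = S' := by
  obtain ⟨g, hg⟩ := SegreAux.to_std S hS
  obtain ⟨k, hk⟩ := SegreAux.to_std S' hS'
  refine ⟨k⁻¹ * g, ?_⟩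
  have h : S.image (fun σ => (k⁻¹ * g) * σ * (k⁻¹ * g)⁻¹)
      = (S.image (fun σ => g * σ * g⁻¹)).image (fun σ => k⁻¹ * σ * k) := by
    rw [Finset.image_image]
    refine Finset.image_congr (fun σ _ => ?_)
    simp [mul_assoc]
  rw [h, hg, ← hk, Finset.image_image]
  refine (Finset.image_congr (g := id) (fun σ _ => ?_)).trans Finset.image_id
  simp [mul_assoc]
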